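/- arXiv:1405.7546 — 3 statements merged into one kernel-verified Lean document; each statement's English description precedes it below -/
import Mathlib

section
/- Let n ≥ 2 be an even integer. The T-ideal of polynomial identities of the relatively free algebra F_n(A) is generated as a T-ideal by the two polynomials [x₁,x₂][x₃,x₄,x₅] and [x₁,x₂][x₃,x₄]⋯[x_{n+3},x_{n+4}] (a product of (n+4)/2 commutators in n+4 distinct variables). -/
noncomputable section

/-- `f ∈ K⟨X⟩` (with set of variables `X`) is a polynomial identity of the `K`-algebra `R`:
every substitution of elements of `R` for the variables (i.e. every `K`-algebra homomorphism
from the free algebra to `R`) kills `f`. -/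
def IsPI (K : Type) [Field K] {X : Type} (R : Type) [Ring R] [Algebra K R]
    (f : FreeAlgebra K X) : Prop :=
  ∀ φ : FreeAlgebra K X →ₐ[K] R, φ f = 0

/-- `T(R)`: the set of polynomial identities of `R` inside `K⟨x₁, x₂, …⟩`
(the free unital associative algebra on countably many variables, indexed by `ℕ`). -/
def TId (K : Type) [Field K] (R : Type) [Ring R] [Algebra K R] : Set (FreeAlgebra K ℕ) :=
  {f | IsPI K R f}

/-- A two-sided ideal of `K⟨X⟩` is a T-ideal when it is invariant under all algebra
endomorphisms of `K⟨X⟩`. -/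
def IsTIdeal (K : Type) [Field K] (I : TwoSidedIdeal (FreeAlgebra K ℕ)) : Prop :=
  ∀ φ : FreeAlgebra K ℕ →ₐ[K] FreeAlgebra K ℕ, ∀ f ∈ I, φ f ∈ I

/-- `⟨F⟩^T`: the smallest T-ideal of `K⟨X⟩` containing the set `F`. -/
def TIdealGen (K : Type) [Field K] (F : Set (FreeAlgebra K ℕ)) : Set (FreeAlgebra K ℕ) :=
  {g | ∀ I : TwoSidedIdeal (FreeAlgebra K ℕ), IsTIdeal K I → F ⊆ (I : Set (FreeAlgebra K ℕ)) → g ∈ I}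

/-- The commutator `[a, b] = a * b - b * a`. -/
def br {R : Type} [Ring R] (a b : R) : R := a * b - b * a

/-- The left-normed commutator `[a, b, b, …, b]` with `k` occurrences of `b`. -/
def commPow {R : Type} [Ring R] (a b : R) (k : ℕ) : R := (fun y => br y b)^[k] a

/-- The variable `xᵢ` of `K⟨x₁, x₂, …⟩` (1-based indexing). -/
def xv (K : Type) [Field K] (i : ℕ) : FreeAlgebra K ℕ := FreeAlgebra.ι K i

/-- The product of commutators `[x₁,x₂][x₃,x₄]⋯[x_{2k-1},x_{2k}]`. -/
def chainProd (K : Type) [Field K] (k : ℕ) : FreeAlgebra K ℕ :=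
  ((List.range k).map fun i => br (xv K (2 * i + 1)) (xv K (2 * i + 2))).prod

/-- The Grassmann (exterior) algebra of an infinite dimensional `K`-vector space
with basis `e₁, e₂, …`. -/
abbrev Einf (K : Type) [Field K] : Type := ExteriorAlgebra K (ℕ →₀ K)

/-- The Grassmann (exterior) algebra `E⁽ⁿ⁾` of an `n`-dimensional `K`-vector space. -/
abbrev Efin (K : Type) [Field K] (n : ℕ) : Type := ExteriorAlgebra K (Fin n → K)

/-- The even part `E₀` of the Grassmann algebra of `V`. -/
def evenPart (K V : Type) [Field K] [AddCommGroup V] [Module K V] :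
    Submodule K (ExteriorAlgebra K V) :=
  CliffordAlgebra.evenOdd (0 : QuadraticForm K V) 0

/-- The odd part `E₁` of the Grassmann algebra of `V`. -/
def oddPart (K V : Type) [Field K] [AddCommGroup V] [Module K V] :
    Submodule K (ExteriorAlgebra K V) :=
  CliffordAlgebra.evenOdd (0 : QuadraticForm K V) 1

section matrixAlgebras

variable (K V : Type) [Field K] [AddCommGroup V] [Module K V]

private theorem evenPart_mul_mem {a b : ExteriorAlgebra K V}
    (ha : a ∈ evenPart K V) (hb : b ∈ evenPart K V) : a * b ∈ evenPart K V := by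
  have := CliffordAlgebra.evenOdd_mul_le (Q := (0 : QuadraticForm K V)) 0 0
    (Submodule.mul_mem_mul ha hb)
  simpa [evenPart] using this

private theorem evenPart_one_mem : (1 : ExteriorAlgebra K V) ∈ evenPart K V :=
  SetLike.one_mem_graded _

private theorem evenPart_algebraMap_mem (c : K) :
    algebraMap K (ExteriorAlgebra K V) c ∈ evenPart K V :=
  SetLike.algebraMap_mem_graded _ c

/-- The algebra `A` (over the Grassmann algebra of `V`): the subalgebra of `2 × 2`
matrices over `E = Λ(V)` whose `(1,1)` entry lies in `E₀`, whose `(2,1)` entry is `0`,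
and whose `(1,2)` and `(2,2)` entries are arbitrary. -/
def algA : Subalgebra K (Matrix (Fin 2) (Fin 2) (ExteriorAlgebra K V)) where
  carrier := {M | M 0 0 ∈ evenPart K V ∧ M 1 0 = 0}
  mul_mem' := by
    rintro a b ⟨ha0, ha1⟩ ⟨hb0, hb1⟩
    refine ⟨?_, ?_⟩
    · have h : (a * b) 0 0 = a 0 0 * b 0 0 + a 0 1 * b 1 0 := by
        simp [Matrix.mul_apply, Fin.sum_univ_two]
      rw [h, hb1, mul_zero, add_zero]
      exact evenPart_mul_mem K V ha0 hb0
    · have h : (a * b) 1 0 = a 1 0 * b 0 0 + a 1 1 * b 1 0 := by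
        simp [Matrix.mul_apply, Fin.sum_univ_two]
      rw [h, ha1, hb1, zero_mul, mul_zero, add_zero]
  one_mem' := by
    refine ⟨?_, ?_⟩
    · rw [Matrix.one_apply_eq]; exact evenPart_one_mem K V
    · exact Matrix.one_apply_ne (by decide)
  add_mem' := by
    rintro a b ⟨ha0, ha1⟩ ⟨hb0, hb1⟩
    exact ⟨Submodule.add_mem _ ha0 hb0, by simp [ha1, hb1]⟩
  zero_mem' := ⟨Submodule.zero_mem _, rfl⟩
  algebraMap_mem' := fun c => by
    refine ⟨?_, ?_⟩
    · rw [Matrix.algebraMap_matrix_apply, if_pos rfl]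
      exact evenPart_algebraMap_mem K V c
    · rw [Matrix.algebraMap_matrix_apply, if_neg (by decide)]

end matrixAlgebras

section matrixAlgebras2

variable (K V : Type) [Field K] [AddCommGroup V] [Module K V]

private theorem oddPart_mul_mem_even {a b : ExteriorAlgebra K V}
    (ha : a ∈ oddPart K V) (hb : b ∈ oddPart K V) : a * b ∈ evenPart K V := by
  have := CliffordAlgebra.evenOdd_mul_le (Q := (0 : QuadraticForm K V)) 1 1
    (Submodule.mul_mem_mul ha hb)
  have h2 : ((1 : ZMod 2) + 1) = 0 := by decide
  rw [h2] at this
  exact this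

private theorem even_mul_odd_mem {a b : ExteriorAlgebra K V}
    (ha : a ∈ evenPart K V) (hb : b ∈ oddPart K V) : a * b ∈ oddPart K V := by
  have := CliffordAlgebra.evenOdd_mul_le (Q := (0 : QuadraticForm K V)) 0 1
    (Submodule.mul_mem_mul ha hb)
  rw [zero_add] at this
  exact this

private theorem odd_mul_even_mem {a b : ExteriorAlgebra K V}
    (ha : a ∈ oddPart K V) (hb : b ∈ evenPart K V) : a * b ∈ oddPart K V := by
  have := CliffordAlgebra.evenOdd_mul_le (Q := (0 : QuadraticForm K V)) 1 0
    (Submodule.mul_mem_mul ha hb)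
  rw [add_zero] at this
  exact this

/-- The algebra `A′` (over the Grassmann algebra of `V`): the subalgebra of `2 × 2`
matrices over `E = Λ(V)` whose `(2,2)` entry lies in `E₀`, whose `(2,1)` entry is `0`,
and whose `(1,1)` and `(1,2)` entries are arbitrary. -/
def algA' : Subalgebra K (Matrix (Fin 2) (Fin 2) (ExteriorAlgebra K V)) where
  carrier := {M | M 1 1 ∈ evenPart K V ∧ M 1 0 = 0}
  mul_mem' := by
    rintro a b ⟨ha0, ha1⟩ ⟨hb0, hb1⟩
    refine ⟨?_, ?_⟩
    · have h : (a * b) 1 1 = a 1 0 * b 0 1 + a 1 1 * b 1 1 := by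
        simp [Matrix.mul_apply, Fin.sum_univ_two]
      rw [h, ha1, zero_mul, zero_add]
      exact evenPart_mul_mem K V ha0 hb0
    · have h : (a * b) 1 0 = a 1 0 * b 0 0 + a 1 1 * b 1 0 := by
        simp [Matrix.mul_apply, Fin.sum_univ_two]
      rw [h, ha1, hb1, zero_mul, mul_zero, add_zero]
  one_mem' := by
    refine ⟨?_, ?_⟩
    · rw [Matrix.one_apply_eq]; exact evenPart_one_mem K V
    · exact Matrix.one_apply_ne (by decide)
  add_mem' := by
    rintro a b ⟨ha0, ha1⟩ ⟨hb0, hb1⟩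
    exact ⟨Submodule.add_mem _ ha0 hb0, by simp [ha1, hb1]⟩
  zero_mem' := ⟨Submodule.zero_mem _, rfl⟩
  algebraMap_mem' := fun c => by
    refine ⟨?_, ?_⟩
    · rw [Matrix.algebraMap_matrix_apply, if_pos rfl]
      exact evenPart_algebraMap_mem K V c
    · rw [Matrix.algebraMap_matrix_apply, if_neg (by decide)]

/-- The algebra `M_{1,1}` (over the Grassmann algebra of `V`): the subalgebra of `2 × 2`
matrices over `E = Λ(V)` whose diagonal entries lie in `E₀` and whose off-diagonal entries
lie in `E₁`. -/
def m11 : Subalgebra K (Matrix (Fin 2) (Fin 2) (ExteriorAlgebra K V)) where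
  carrier := {M | M 0 0 ∈ evenPart K V ∧ M 1 1 ∈ evenPart K V ∧
    M 0 1 ∈ oddPart K V ∧ M 1 0 ∈ oddPart K V}
  mul_mem' := by
    rintro a b ⟨ha00, ha11, ha01, ha10⟩ ⟨hb00, hb11, hb01, hb10⟩
    have h00 : (a * b) 0 0 = a 0 0 * b 0 0 + a 0 1 * b 1 0 := by
      simp [Matrix.mul_apply, Fin.sum_univ_two]
    have h11 : (a * b) 1 1 = a 1 0 * b 0 1 + a 1 1 * b 1 1 := by
      simp [Matrix.mul_apply, Fin.sum_univ_two]
    have h01 : (a * b) 0 1 = a 0 0 * b 0 1 + a 0 1 * b 1 1 := by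
      simp [Matrix.mul_apply, Fin.sum_univ_two]
    have h10 : (a * b) 1 0 = a 1 0 * b 0 0 + a 1 1 * b 1 0 := by
      simp [Matrix.mul_apply, Fin.sum_univ_two]
    refine ⟨?_, ?_, ?_, ?_⟩
    · rw [h00]
      exact Submodule.add_mem _ (evenPart_mul_mem K V ha00 hb00)
        (oddPart_mul_mem_even K V ha01 hb10)
    · rw [h11]
      exact Submodule.add_mem _ (oddPart_mul_mem_even K V ha10 hb01)
        (evenPart_mul_mem K V ha11 hb11)
    · rw [h01]
      exact Submodule.add_mem _ (even_mul_odd_mem K V ha00 hb01)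
        (odd_mul_even_mem K V ha01 hb11)
    · rw [h10]
      exact Submodule.add_mem _ (odd_mul_even_mem K V ha10 hb00)
        (even_mul_odd_mem K V ha11 hb10)
  one_mem' := by
    refine ⟨?_, ?_, ?_, ?_⟩
    · rw [Matrix.one_apply_eq]; exact evenPart_one_mem K V
    · rw [Matrix.one_apply_eq]; exact evenPart_one_mem K V
    · rw [Matrix.one_apply_ne (by decide)]; exact Submodule.zero_mem _
    · rw [Matrix.one_apply_ne (by decide)]; exact Submodule.zero_mem _
  add_mem' := by
    rintro a b ⟨ha00, ha11, ha01, ha10⟩ ⟨hb00, hb11, hb01, hb10⟩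
    exact ⟨Submodule.add_mem _ ha00 hb00, Submodule.add_mem _ ha11 hb11,
      Submodule.add_mem _ ha01 hb01, Submodule.add_mem _ ha10 hb10⟩
  zero_mem' := ⟨Submodule.zero_mem _, Submodule.zero_mem _,
    Submodule.zero_mem _, Submodule.zero_mem _⟩
  algebraMap_mem' := fun c => by
    refine ⟨?_, ?_, ?_, ?_⟩
    · rw [Matrix.algebraMap_matrix_apply, if_pos rfl]
      exact evenPart_algebraMap_mem K V c
    · rw [Matrix.algebraMap_matrix_apply, if_pos rfl]
      exact evenPart_algebraMap_mem K V c
    · rw [Matrix.algebraMap_matrix_apply, if_neg (by decide)]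
      exact Submodule.zero_mem _
    · rw [Matrix.algebraMap_matrix_apply, if_neg (by decide)]
      exact Submodule.zero_mem _

end matrixAlgebras2

/-- The relatively free algebra `F_n(R) = K⟨x₁, …, xₙ⟩ / (K⟨x₁, …, xₙ⟩ ∩ T(R))` of rank `n`
of the variety generated by `R`: the quotient of the free algebra on `n` variables by the
ideal of polynomial identities of `R` in those variables. -/
abbrev RelFree (K : Type) [Field K] (R : Type) [Ring R] [Algebra K R] (n : ℕ) : Type :=
  RingQuot (fun f g : FreeAlgebra K (Fin n) => IsPI K R (f - g))

end

section CommutatorProducts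

variable {X Q : Type} [Ring Q]

/-- The product of commutators `[x a₁, x a₂][x a₃, x a₄]⋯` along a list of indices of even length
(and `0` for a list of odd length). -/
def commProd (x : X → Q) : List X → Q
  | [] => 1
  | [_] => 0
  | a :: b :: l => br (x a) (x b) * commProd x l

theorem map_br {R S : Type} [Ring R] [Ring S] (φ : R →+* S) (a b : R) :
    φ (br a b) = br (φ a) (φ b) := by
  simp [br]

theorem map_commProd {S : Type} [Ring S] (φ : Q →+* S) (x : X → Q) :
    ∀ l : List X, φ (commProd x l) = commProd (fun a => φ (x a)) l
  | [] => by simp [commProd]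
  | [_] => by simp [commProd]
  | a :: b :: l => by simp [commProd, map_br, map_commProd φ x l]

/-- If commutators are central then products of commutators are alternating. -/
theorem br_mul_br_swap (hQ : ∀ a b c : Q, br (br a b) c = 0) (a b c d : Q) :
    br a c * br b d + br a d * br b c = 0 := by
  have h1 := hQ (a * b) c d
  have h2 := hQ b c d
  have h3 := hQ a c d
  have h : br (br (a * b) c) d =
      a * br (br b c) d + br (br a c) d * b + (br a d * br b c + br a c * br b d) := by
    simp only [br]; noncomm_ring
  rw [h1, h2, h3] at h
  rw [add_comm]
  simpa using h.symm

theorem br_comm_mul (hQ : ∀ a b c : Q, br (br a b) c = 0) (a b c : Q) :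
    br a b * c = c * br a b :=
  sub_eq_zero.mp (hQ a b c)

theorem commProd_mul_comm (hQ : ∀ a b c : Q, br (br a b) c = 0) (x : X → Q) (r : Q) :
    ∀ l : List X, commProd x l * r = r * commProd x l
  | [] => by simp [commProd]
  | [_] => by simp [commProd]
  | a :: b :: l => by
    rw [commProd, mul_assoc, commProd_mul_comm hQ x r l, ← mul_assoc, br_comm_mul hQ, mul_assoc]

theorem commProd_swap (hQ : ∀ a b c : Q, br (br a b) c = 0) (x : X → Q) (a b : X) (l : List X) :
    ∀ p : List X, commProd x (p ++ a :: b :: l) = -commProd x (p ++ b :: a :: l)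
  | [] => by
    simp only [List.nil_append, commProd, br]
    noncomm_ring
  | [c] => by
    cases l with
    | nil => simp [commProd]
    | cons d l =>
      simp only [List.cons_append, List.nil_append, commProd, ← mul_assoc]
      rw [← neg_mul]
      congr 1
      have h := br_mul_br_swap hQ (x c) (x b) (x a) (x d)
      have h' : br (x c) (x a) * br (x b) (x d) = -(br (x c) (x d) * br (x b) (x a)) :=
        eq_neg_of_add_eq_zero_left h
      rw [h']
      have h2 := br_mul_br_swap hQ (x c) (x a) (x b) (x d)
      rw [eq_neg_of_add_eq_zero_left h2]
      simp only [br]; noncomm_ring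
  | c :: d :: p => by
    simp only [List.cons_append, commProd]
    rw [commProd_swap hQ x a b l p, mul_neg]

theorem commProd_perm_append (hQ : ∀ a b c : Q, br (br a b) c = 0) (x : X → Q) {l l' : List X}
    (h : l.Perm l') : ∀ p : List X, commProd x (p ++ l) = commProd x (p ++ l') ∨
      commProd x (p ++ l) = -commProd x (p ++ l') := by
  induction h with
  | nil => exact fun _ => Or.inl rfl
  | cons a _ ih => intro p; simpa using ih (p ++ [a])
  | swap a b l => exact fun p => Or.inr (commProd_swap hQ x b a l p)
  | trans _ _ ih₁ ih₂ =>
    intro p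
    rcases ih₁ p with h₁ | h₁ <;> rcases ih₂ p with h₂ | h₂ <;> simp [h₁, h₂]

theorem commProd_perm (hQ : ∀ a b c : Q, br (br a b) c = 0) (x : X → Q) {l l' : List X}
    (h : l.Perm l') : commProd x l = commProd x l' ∨ commProd x l = -commProd x l' :=
  commProd_perm_append hQ x h []

theorem commProd_eq_zero_of_not_nodup (hQ : ∀ a b c : Q, br (br a b) c = 0) (x : X → Q)
    {l : List X} (h : ¬ l.Nodup) : commProd x l = 0 := by
  obtain ⟨a, ha⟩ := List.exists_duplicate_iff_not_nodup.mpr h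
  obtain ⟨l', hl'⟩ := (List.duplicate_iff_sublist.mp ha).exists_perm_append
  have h0 : commProd x ([a, a] ++ l') = 0 := by simp [commProd, br]
  rcases commProd_perm hQ x hl' with h | h <;> rw [h, h0]
  exact neg_zero

/-- Up to sign, a product of commutators only depends on the set of indices. -/
theorem commProd_mem_span (hQ : ∀ a b c : Q, br (br a b) c = 0) (x : ℕ → Q) {l : List ℕ}
    {k : ℕ} (hl : l.length = k) :
    commProd x l ∈ Ideal.span ((fun S : Finset ℕ => commProd x S.toList) '' {S | S.card = k}) := by
  by_cases hn : l.Nodup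
  · have hp : l.Perm l.toFinset.toList := (List.toFinset_toList hn).symm
    have hm : commProd x l.toFinset.toList ∈
        Ideal.span ((fun S : Finset ℕ => commProd x S.toList) '' {S | S.card = k}) :=
      Ideal.subset_span ⟨l.toFinset, by simp [List.toFinset_card_of_nodup hn, hl], rfl⟩
    rcases commProd_perm hQ x hp with h | h <;> rw [h]
    · exact hm
    · exact neg_mem hm
  · rw [commProd_eq_zero_of_not_nodup hQ x hn]
    exact zero_mem _

theorem exists_commProd_eq_range_prod (x : X → Q) : ∀ (k : ℕ) (l : List X), l.length = 2 * k →
    ∃ a b : ℕ → Q, commProd x l = ((List.range k).map fun i => br (a i) (b i)).prod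
  | 0, [], _ => ⟨0, 0, by simp [commProd]⟩
  | k + 1, [], hl => by simp at hl
  | k + 1, [_], hl => by simp at hl; omega
  | k + 1, c :: d :: l, hl => by
    obtain ⟨a, b, h⟩ := exists_commProd_eq_range_prod x k l (by simp at hl; omega)
    refine ⟨fun i => Nat.casesOn i (x c) a, fun i => Nat.casesOn i (x d) b, ?_⟩
    rw [commProd, h, List.range_succ_eq_map]
    simp [Function.comp_def]

end CommutatorProducts

section Grassmann

variable {K V : Type} [Field K] [AddCommGroup V] [Module K V]

/-- The grade involution of the Grassmann algebra. -/
def gradeInv (K V : Type) [Field K] [AddCommGroup V] [Module K V] :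
    ExteriorAlgebra K V →ₐ[K] ExteriorAlgebra K V :=
  CliffordAlgebra.involute

theorem gradeInv_ι (v : V) : gradeInv K V (ExteriorAlgebra.ι K v) = -ExteriorAlgebra.ι K v :=
  CliffordAlgebra.involute_ι v

theorem gradeInv_gradeInv (a : ExteriorAlgebra K V) : gradeInv K V (gradeInv K V a) = a :=
  CliffordAlgebra.involute_involute a

theorem ι_mul_ι_anticomm (v w : V) : ExteriorAlgebra.ι K v * ExteriorAlgebra.ι K w =
    -(ExteriorAlgebra.ι K w * ExteriorAlgebra.ι K v) :=
  eq_neg_of_add_eq_zero_left (ExteriorAlgebra.ι_add_mul_swap v w)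

theorem mul_ι_eq (a : ExteriorAlgebra K V) (v : V) :
    a * ExteriorAlgebra.ι K v = ExteriorAlgebra.ι K v * gradeInv K V a := by
  induction a using ExteriorAlgebra.induction with
  | algebraMap r => rw [AlgHom.commutes, Algebra.commutes]
  | ι w => rw [gradeInv_ι, mul_neg, ι_mul_ι_anticomm]
  | mul a b ha hb => rw [mul_assoc, hb, ← mul_assoc, ha, map_mul, mul_assoc]
  | add a b ha hb => rw [add_mul, ha, hb, map_add, mul_add]

theorem mul_comm_of_gradeInv_eq {a : ExteriorAlgebra K V} (ha : gradeInv K V a = a)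
    (b : ExteriorAlgebra K V) : a * b = b * a := by
  induction b using ExteriorAlgebra.induction with
  | algebraMap r => rw [Algebra.commutes]
  | ι w => rw [mul_ι_eq, ha]
  | mul b c hb hc => rw [← mul_assoc, hb, mul_assoc, hc, mul_assoc]
  | add b c hb hc => rw [mul_add, hb, hc, add_mul]

theorem mul_comm_of_mem_evenPart {a : ExteriorAlgebra K V} (ha : a ∈ evenPart K V)
    (b : ExteriorAlgebra K V) : a * b = b * a :=
  mul_comm_of_gradeInv_eq (CliffordAlgebra.involute_eq_of_mem_even ha) b

theorem exteriorAlgebra_br_br [CharZero K] (a b c : ExteriorAlgebra K V) :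
    br (br a b) c = 0 := by
  have key : ∀ z : ExteriorAlgebra K V, ∃ y, gradeInv K V y = -y ∧
      ∀ w, br z w = br y w ∧ br w z = br w y := by
    intro z
    refine ⟨(2⁻¹ : K) • (z - gradeInv K V z), ?_, ?_⟩
    · rw [map_smul, map_sub, gradeInv_gradeInv, ← smul_neg, neg_sub]
    · have hz : z = (2⁻¹ : K) • (z - gradeInv K V z) + (2⁻¹ : K) • (z + gradeInv K V z) := by
        rw [← smul_add, sub_add_add_cancel, ← two_smul K z, smul_smul,
          inv_mul_cancel₀ two_ne_zero, one_smul]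
      have he : gradeInv K V ((2⁻¹ : K) • (z + gradeInv K V z)) =
          (2⁻¹ : K) • (z + gradeInv K V z) := by
        rw [map_smul, map_add, gradeInv_gradeInv, add_comm]
      intro w
      have hc := mul_comm_of_gradeInv_eq he w
      generalize (2⁻¹ : K) • (z - gradeInv K V z) = y at *
      generalize (2⁻¹ : K) • (z + gradeInv K V z) = e at *
      subst hz
      simp only [br, add_mul, mul_add, hc]
      exact ⟨by abel, by abel⟩
  obtain ⟨a', ha', ha⟩ := key a
  obtain ⟨b', hb', hb⟩ := key b
  rw [(ha b).1, (hb a').2]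
  refine sub_eq_zero.mpr (mul_comm_of_gradeInv_eq ?_ c)
  simp [br, ha', hb']

theorem map_ι_prod_eq_ιMulti {X : Type} (v : X → V) (l : List X) :
    (l.map fun j => ExteriorAlgebra.ι K (v j)).prod =
      ExteriorAlgebra.ιMulti K l.length fun i => v (l.get i) := by
  rw [ExteriorAlgebra.ιMulti_apply]
  congr 1
  exact List.ext_get (by simp) (by simp)

theorem ι_mul_map_ι_prod {X : Type} (v : X → V) {l : List X} {a : X} (h : a ∈ l) :
    ExteriorAlgebra.ι K (v a) * (l.map fun j => ExteriorAlgebra.ι K (v j)).prod = 0 := by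
  obtain ⟨i, rfl⟩ := List.get_of_mem h
  rw [map_ι_prod_eq_ιMulti]
  exact ExteriorAlgebra.ι_mul_prod_list (R := K) (fun i : Fin l.length => v (l.get i)) i

theorem map_ι_prod_ne_zero (K : Type) [Field K] {l : List ℕ} (v : ℕ → ℕ →₀ K)
    (hv : ∀ i : Fin l.length, v (l.get i) = Finsupp.single (i : ℕ) 1) :
    (l.map fun j => ExteriorAlgebra.ι K (v j)).prod ≠ 0 := by
  intro h
  rw [map_ι_prod_eq_ιMulti] at h
  have h1 := congrArg (ExteriorAlgebra.liftAlternating fun n : ℕ =>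
    (Matrix.detRowAlternating (R := K) (n := Fin n)).compLinearMap
      (LinearMap.pi fun j : Fin n => Finsupp.lapply (j : ℕ))) h
  rw [ExteriorAlgebra.liftAlternating_apply_ιMulti, map_zero] at h1
  have h2 : (fun i : Fin l.length => (LinearMap.pi fun j : Fin l.length =>
      (Finsupp.lapply (j : ℕ) : (ℕ →₀ K) →ₗ[K] K)) (v (l.get i))) =
      (1 : Matrix (Fin l.length) (Fin l.length) K) := by
    ext i j
    rw [hv]
    simp [Matrix.one_apply, Finsupp.single_apply, Fin.ext_iff]
  have h3 : Matrix.det (fun i : Fin l.length => (LinearMap.pi fun j : Fin l.length =>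
      (Finsupp.lapply (j : ℕ) : (ℕ →₀ K) →ₗ[K] K)) (v (l.get i))) = 0 := h1
  rw [h2, Matrix.det_one] at h3
  exact one_ne_zero h3

/-- Products of commutators of elements `scalar + vector` in the Grassmann algebra. -/
theorem commProd_algebraMap_add_ι {X : Type} (α : X → K) (v : X → V) :
    ∀ (k : ℕ) (l : List X), l.length = 2 * k →
    commProd (fun j => algebraMap K (ExteriorAlgebra K V) (α j) + ExteriorAlgebra.ι K (v j)) l =
      (2 ^ k : K) • (l.map fun j => ExteriorAlgebra.ι K (v j)).prod
  | 0, [], _ => by simp [commProd]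
  | k + 1, [], hl => by simp at hl
  | k + 1, [_], hl => by simp at hl; omega
  | k + 1, c :: d :: l, hl => by
    have h : br (algebraMap K (ExteriorAlgebra K V) (α c) + ExteriorAlgebra.ι K (v c))
        (algebraMap K (ExteriorAlgebra K V) (α d) + ExteriorAlgebra.ι K (v d)) =
        (2 : K) • (ExteriorAlgebra.ι K (v c) * ExteriorAlgebra.ι K (v d)) := by
      have h1 := Algebra.commutes (α c) (ExteriorAlgebra.ι K (v d))
      have h2 := Algebra.commutes (α d) (ExteriorAlgebra.ι K (v c))
      have h3 := Algebra.commutes (α c) (algebraMap K (ExteriorAlgebra K V) (α d))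
      have h4 := ι_mul_ι_anticomm (K := K) (v d) (v c)
      simp only [br, add_mul, mul_add, h1, h2, h3, h4, two_smul]
      abel
    rw [commProd, h, commProd_algebraMap_add_ι α v k l (by simp at hl; omega)]
    simp [smul_smul, pow_succ, mul_assoc]

end Grassmann

section FoxCalculus

variable (K : Type) [Field K]

/-- A fixed word in the variables with prescribed content. -/
noncomputable def wordOf (M : Multiset ℕ) : FreeAlgebra K ℕ := (M.toList.map (FreeAlgebra.ι K)).prod

/-- The substitution `x_j ↦ [[α_j, τ_j], [0, g_j]]`. -/
noncomputable def triEval {S : Type} [Ring S] [Algebra K S] (α τ : ℕ → K) (g : ℕ → S) :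
    FreeAlgebra K ℕ →ₐ[K] Matrix (Fin 2) (Fin 2) S :=
  FreeAlgebra.lift K fun j => !![algebraMap K S (α j), algebraMap K S (τ j); 0, g j]

variable {K}

theorem triEval_ι {S : Type} [Ring S] [Algebra K S] (α τ : ℕ → K) (g : ℕ → S) (j : ℕ) :
    triEval K α τ g (FreeAlgebra.ι K j) =
      !![algebraMap K S (α j), algebraMap K S (τ j); 0, g j] := by
  simp [triEval]

theorem triEval_entries {S : Type} [Ring S] [Algebra K S] (α τ : ℕ → K) (g : ℕ → S)
    (f : FreeAlgebra K ℕ) :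
    triEval K α τ g f 0 0 = algebraMap K S (FreeAlgebra.lift K α f) ∧
      triEval K α τ g f 1 0 = 0 ∧ triEval K α τ g f 1 1 = FreeAlgebra.lift K g f := by
  induction f using FreeAlgebra.induction with
  | grade0 r => simp [Matrix.algebraMap_matrix_apply]
  | grade1 j => simp [triEval_ι]
  | mul a b ha hb =>
    obtain ⟨ha0, ha1, ha2⟩ := ha
    obtain ⟨hb0, hb1, hb2⟩ := hb
    simp [Matrix.mul_apply, Fin.sum_univ_two, ha0, ha1, ha2, hb0, hb1, hb2]
  | add a b ha hb =>
    obtain ⟨ha0, ha1, ha2⟩ := ha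
    obtain ⟨hb0, hb1, hb2⟩ := hb
    simp [ha0, ha1, ha2, hb0, hb1, hb2]

/-- `p` and `c` are the abelianization and the Fox derivatives of `f`: they reconstruct `f` and
compute the values of `f` under scalar and triangular substitutions. -/
structure IsFoxExpansion (f : FreeAlgebra K ℕ) (p : Multiset ℕ →₀ K)
    (c : Multiset ℕ × ℕ →₀ FreeAlgebra K ℕ) : Prop where
  eq_sum : f = (p.sum fun M r => r • wordOf K M) +
    c.sum fun Mi h => (wordOf K Mi.1 * FreeAlgebra.ι K Mi.2 - wordOf K (Mi.2 ::ₘ Mi.1)) * h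
  eval : ∀ α : ℕ → K, FreeAlgebra.lift K α f = p.sum fun M r => (M.map α).prod • r
  triEval : ∀ (S : Type) [Ring S] [Algebra K S] (α τ : ℕ → K) (g : ℕ → S),
    triEval K α τ g f 0 1 =
      c.sum fun Mi h => ((Mi.1.map α).prod * τ Mi.2) • FreeAlgebra.lift K g h

namespace IsFoxExpansion

theorem one : IsFoxExpansion (K := K) 1 (Finsupp.single 0 1) 0 where
  eq_sum := by simp [wordOf]
  eval α := by simp
  triEval S _ _ α τ g := by simp

theorem smul {f : FreeAlgebra K ℕ} {p c} (h : IsFoxExpansion f p c) (r : K) :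
    IsFoxExpansion (r • f) (r • p) (r • c) where
  eq_sum := by
    conv_lhs => rw [h.eq_sum]
    rw [Finsupp.sum_smul_index' (by simp), Finsupp.sum_smul_index' (by simp), smul_add,
      Finsupp.smul_sum, Finsupp.smul_sum]
    simp [mul_smul]
  eval α := by
    rw [map_smul, h.eval, Finsupp.sum_smul_index' (by simp), Finsupp.smul_sum]
    simp [mul_left_comm]
  triEval S _ _ α τ g := by
    rw [map_smul, Matrix.smul_apply, h.triEval, Finsupp.sum_smul_index' (by simp),
      Finsupp.smul_sum]
    refine Finsupp.sum_congr fun Mi _ => ?_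
    rw [map_smul, smul_comm]

theorem add {f f' : FreeAlgebra K ℕ} {p c p' c'} (h : IsFoxExpansion f p c)
    (h' : IsFoxExpansion f' p' c') : IsFoxExpansion (f + f') (p + p') (c + c') where
  eq_sum := by
    conv_lhs => rw [h.eq_sum, h'.eq_sum]
    rw [Finsupp.sum_add_index' (by simp) (by simp [add_smul]),
      Finsupp.sum_add_index' (by simp) (by simp [mul_add])]
    abel
  eval α := by
    rw [map_add, h.eval, h'.eval, Finsupp.sum_add_index' (by simp) (by simp [mul_add])]
  triEval S _ _ α τ g := by
    rw [map_add, Matrix.add_apply, h.triEval, h'.triEval,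
      Finsupp.sum_add_index' (by simp) (by simp [smul_add])]

/-- The Fox derivatives of `f * x_i`, where `p` and `c` are the abelianization and the Fox
derivatives of `f`. -/
noncomputable def mulDeriv (p : Multiset ℕ →₀ K) (c : Multiset ℕ × ℕ →₀ FreeAlgebra K ℕ) (i : ℕ) :
    Multiset ℕ × ℕ →₀ FreeAlgebra K ℕ :=
  (p.sum fun M r => Finsupp.single (M, i) (algebraMap K (FreeAlgebra K ℕ) r)) +
    c.mapRange (· * FreeAlgebra.ι K i) (zero_mul _)

theorem sum_mulDeriv {N : Type} [AddCommMonoid N] (p : Multiset ℕ →₀ K)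
    (c : Multiset ℕ × ℕ →₀ FreeAlgebra K ℕ) (i : ℕ)
    (G : Multiset ℕ × ℕ → FreeAlgebra K ℕ → N) (h0 : ∀ a, G a 0 = 0)
    (hadd : ∀ a x y, G a (x + y) = G a x + G a y) :
    (mulDeriv p c i).sum G = (p.sum fun M r => G (M, i) (algebraMap K _ r)) +
      c.sum fun Mi h => G Mi (h * FreeAlgebra.ι K i) := by
  rw [mulDeriv, Finsupp.sum_add_index' h0 hadd, Finsupp.sum_sum_index h0 hadd,
    Finsupp.sum_mapRange_index h0]
  congr 1
  exact Finsupp.sum_congr fun M _ => Finsupp.sum_single_index (h0 _)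

theorem mul_ι {f : FreeAlgebra K ℕ} {p c} (h : IsFoxExpansion f p c) (i : ℕ) :
    IsFoxExpansion (f * FreeAlgebra.ι K i) (p.mapDomain (i ::ₘ ·)) (mulDeriv p c i) where
  eq_sum := by
    conv_lhs => rw [h.eq_sum]
    rw [sum_mulDeriv _ _ _ _ (by simp) (by simp [mul_add]),
      Finsupp.sum_mapDomain_index (by simp) (by simp [add_smul]), ← add_assoc, add_mul,
      Finsupp.sum_mul, Finsupp.sum_mul, ← Finsupp.sum_add]
    congr 1
    · refine Finsupp.sum_congr fun M _ => ?_
      rw [← Algebra.commutes, ← Algebra.smul_def, smul_sub, smul_mul_assoc]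
      abel
    · exact Finsupp.sum_congr fun Mi _ => mul_assoc _ _ _
  eval α := by
    rw [map_mul, h.eval, Finsupp.sum_mapDomain_index (by simp) (by simp [mul_add]),
      Finsupp.sum_mul]
    refine Finsupp.sum_congr fun M _ => ?_
    simp only [FreeAlgebra.lift_ι_apply, Multiset.map_cons, Multiset.prod_cons, smul_eq_mul]
    ring
  triEval S _ _ α τ g := by
    rw [map_mul, Matrix.mul_apply, Fin.sum_univ_two, (triEval_entries α τ g f).1, h.triEval,
      h.eval, sum_mulDeriv _ _ _ _ (by simp) (by simp [smul_add]), map_finsuppSum,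
      Finsupp.sum_mul, Finsupp.sum_mul, triEval_ι]
    congr 1
    · refine Finsupp.sum_congr fun M _ => ?_
      simp only [Matrix.of_apply, Matrix.cons_val', Matrix.cons_val_zero, Matrix.cons_val_one,
        AlgHom.commutes, ← map_mul, smul_eq_mul, Algebra.smul_def]
      congr 1
      ring
    · refine Finsupp.sum_congr fun Mi _ => ?_
      simp

end IsFoxExpansion

theorem exists_isFoxExpansion (f : FreeAlgebra K ℕ) : ∃ p c, IsFoxExpansion f p c := by
  suffices H : ∀ h : FreeAlgebra K ℕ, (∃ p c, IsFoxExpansion h p c) →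
      ∃ p c, IsFoxExpansion (h * f) p c by
    simpa using H 1 ⟨_, _, .one⟩
  induction f using FreeAlgebra.induction with
  | grade0 r =>
    rintro h ⟨p, c, hpc⟩
    rw [← Algebra.commutes, ← Algebra.smul_def]
    exact ⟨_, _, hpc.smul r⟩
  | grade1 i =>
    rintro h ⟨p, c, hpc⟩
    exact ⟨_, _, hpc.mul_ι i⟩
  | mul a b ha hb =>
    intro h hh
    rw [← mul_assoc]
    exact hb _ (ha _ hh)
  | add a b ha hb =>
    intro h hh
    obtain ⟨p, c, h1⟩ := ha h hh
    obtain ⟨p', c', h2⟩ := hb h hh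
    rw [mul_add]
    exact ⟨_, _, h1.add h2⟩

/-- Over an infinite field, monomial functions are linearly independent. -/
theorem finsupp_eq_zero_of_forall_sum [Infinite K] {V : Type} [AddCommGroup V] [Module K V]
    {c : Multiset ℕ →₀ V} (h : ∀ α : ℕ → K, (c.sum fun M v => (M.map α).prod • v) = 0) :
    c = 0 := by
  ext M
  rw [Finsupp.zero_apply, ← Module.forall_dual_apply_eq_zero_iff K]
  intro ℓ
  have hP : (c.sum fun M v => MvPolynomial.monomial (Multiset.toFinsupp M) (ℓ v)) = 0 := by
    refine MvPolynomial.funext fun α => ?_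
    have h1 := congrArg ℓ (h α)
    rw [map_finsuppSum, map_zero] at h1
    rw [map_finsuppSum, map_zero, ← h1]
    refine Finsupp.sum_congr fun N _ => ?_
    rw [MvPolynomial.eval_monomial, map_smul, smul_eq_mul, mul_comm,
      Finset.prod_multiset_map_count]
    rfl
  have h2 := congrArg (MvPolynomial.coeff (Multiset.toFinsupp M)) hP
  rw [MvPolynomial.coeff_zero] at h2
  rw [← h2, Finsupp.sum, MvPolynomial.coeff_sum]
  simp only [MvPolynomial.coeff_monomial, EmbeddingLike.apply_eq_iff_eq]
  rw [Finset.sum_ite_eq']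
  split_ifs with hM
  · rfl
  · rw [Finsupp.notMem_support_iff.mp hM, map_zero]

theorem prod_map_ι_sub_mem {I : TwoSidedIdeal (FreeAlgebra K ℕ)}
    (hI : ∀ i j, br (FreeAlgebra.ι K i) (FreeAlgebra.ι K j) ∈ I) {l l' : List ℕ}
    (h : l.Perm l') :
    (l.map (FreeAlgebra.ι K)).prod - (l'.map (FreeAlgebra.ι K)).prod ∈ I := by
  induction h with
  | nil => simp [I.zero_mem]
  | cons a _ ih =>
    simpa [mul_sub] using I.mul_mem_left (FreeAlgebra.ι K a) _ ih
  | swap a b l =>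
    simpa [br, sub_mul, mul_assoc] using I.mul_mem_right _ (l.map (FreeAlgebra.ι K)).prod (hI b a)
  | trans _ _ ih₁ ih₂ => simpa using I.add_mem ih₁ ih₂

theorem wordOf_mul_sub_mem {I : TwoSidedIdeal (FreeAlgebra K ℕ)}
    (hI : ∀ i j, br (FreeAlgebra.ι K i) (FreeAlgebra.ι K j) ∈ I) (M : Multiset ℕ) (i : ℕ) :
    wordOf K M * FreeAlgebra.ι K i - wordOf K (i ::ₘ M) ∈ I := by
  have h : (M.toList ++ [i]).Perm (i ::ₘ M).toList := by
    rw [← Multiset.coe_eq_coe]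
    rw [← Multiset.coe_add, Multiset.coe_toList, Multiset.coe_toList, Multiset.coe_singleton,
      add_comm, Multiset.singleton_add]
  simpa [wordOf] using prod_map_ι_sub_mem hI h

/-- A polynomial vanishing on scalars lies in the commutator ideal. -/
theorem mem_of_forall_lift_eq_zero [Infinite K] {I : TwoSidedIdeal (FreeAlgebra K ℕ)}
    (hI : ∀ i j, br (FreeAlgebra.ι K i) (FreeAlgebra.ι K j) ∈ I) {f : FreeAlgebra K ℕ}
    (hf : ∀ α : ℕ → K, FreeAlgebra.lift K α f = 0) : f ∈ I := by
  obtain ⟨p, c, h⟩ := exists_isFoxExpansion f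
  have hp : p = 0 := finsupp_eq_zero_of_forall_sum fun α => by rw [← h.eval, hf]
  rw [h.eq_sum, hp, Finsupp.sum_zero_index, zero_add]
  exact sum_mem fun Mi _ => I.mul_mem_right _ _ (wordOf_mul_sub_mem hI _ _)

/-- If `f` vanishes under triangular substitutions, then it is a combination of products of
elements of the commutator ideal by polynomials vanishing on the right bottom corner. -/
theorem mem_of_forall_triEval_eq_zero [Infinite K] {S : Type} [Ring S] [Algebra K S]
    {G : Set (ℕ → S)} {I : TwoSidedIdeal (FreeAlgebra K ℕ)} {J : Set (FreeAlgebra K ℕ)}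
    {f : FreeAlgebra K ℕ} (hf : ∀ g ∈ G, ∀ α τ : ℕ → K, triEval K α τ g f = 0)
    (hG : G.Nonempty) [Nontrivial S]
    (hJ : ∀ h, (∀ g ∈ G, FreeAlgebra.lift K g h = 0) → h ∈ J)
    (hI : ∀ h ∈ J, ∀ M i, (wordOf K M * FreeAlgebra.ι K i - wordOf K (i ::ₘ M)) * h ∈ I) :
    f ∈ I := by
  obtain ⟨p, c, h⟩ := exists_isFoxExpansion f
  have hp : p = 0 := finsupp_eq_zero_of_forall_sum fun α => by
    obtain ⟨g, hg⟩ := hG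
    have h0 := (triEval_entries α 0 g f).1
    rw [hf g hg, Matrix.zero_apply, eq_comm, map_eq_zero] at h0
    rw [← h.eval, h0]
  rw [h.eq_sum, hp, Finsupp.sum_zero_index, zero_add]
  refine sum_mem fun Mi _ => hI _ (hJ _ fun g hg => ?_) _ _
  obtain ⟨M, i⟩ := Mi
  have hc : c.curry.mapRange (fun q => FreeAlgebra.lift K g (q i)) (by simp) = 0 := by
    refine finsupp_eq_zero_of_forall_sum (K := K) fun α => ?_
    have h1 := h.triEval S α (Pi.single i 1) g
    rw [hf g hg, Matrix.zero_apply, ← Finsupp.sum_curry_index c fun M j h =>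
      ((M.map α).prod * (Pi.single i 1 : ℕ → K) j) • FreeAlgebra.lift K g h] at h1
    rw [Finsupp.sum_mapRange_index (by simp), h1]
    refine Finsupp.sum_congr fun M _ => ?_
    rw [Finsupp.sum, Finset.sum_eq_single i]
    · simp
    · intro j _ hj
      simp [hj]
    · intro hi
      rw [Finsupp.notMem_support_iff.mp hi, map_zero, smul_zero]
  simpa using DFunLike.congr_fun hc M

end FoxCalculus

section GrassmannIdentities

/-- The two-sided ideal generated by all triple commutators. -/
def tripleIdeal (R : Type) [Ring R] : TwoSidedIdeal R :=
  TwoSidedIdeal.span {z | ∃ a b c : R, z = br (br a b) c}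

/-- The quotient by the ideal generated by all triple commutators. -/
abbrev TripleQuot (R : Type) [Ring R] : Type := (tripleIdeal R).ringCon.Quotient

/-- The projection onto the quotient by the ideal generated by all triple commutators. -/
def tripleMk (R : Type) [Ring R] : R →+* TripleQuot R := (tripleIdeal R).ringCon.mk'

theorem tripleMk_surjective (R : Type) [Ring R] : Function.Surjective (tripleMk R) :=
  (tripleIdeal R).ringCon.mk'_surjective

theorem tripleMk_eq_iff {R : Type} [Ring R] {a b : R} :
    tripleMk R a = tripleMk R b ↔ a - b ∈ tripleIdeal R := by
  rw [← sub_eq_zero, ← map_sub, ← TwoSidedIdeal.mem_ker, tripleMk,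
    TwoSidedIdeal.ker_ringCon_mk']

theorem tripleIdeal_le {R : Type} [Ring R] {J : TwoSidedIdeal R}
    (hJ : ∀ a b c, br (br a b) c ∈ J) : tripleIdeal R ≤ J := by
  rw [tripleIdeal, TwoSidedIdeal.span_le]
  rintro _ ⟨a, b, c, rfl⟩
  exact hJ a b c

theorem map_eq_of_tripleMk_eq {R S : Type} [Ring R] [Ring S]
    (hS : ∀ a b c : S, br (br a b) c = 0) (φ : R →+* S) {a b : R}
    (h : tripleMk R a = tripleMk R b) : φ a = φ b := by
  have h1 : tripleIdeal R ≤ TwoSidedIdeal.ker φ := tripleIdeal_le fun a b c => by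
    rw [TwoSidedIdeal.mem_ker, map_br, map_br, hS]
  have h2 := h1 (tripleMk_eq_iff.mp h)
  rwa [TwoSidedIdeal.mem_ker, map_sub, sub_eq_zero] at h2

theorem tripleQuot_br_br {R : Type} [Ring R] (a b c : TripleQuot R) : br (br a b) c = 0 := by
  obtain ⟨a, rfl⟩ := tripleMk_surjective R a
  obtain ⟨b, rfl⟩ := tripleMk_surjective R b
  obtain ⟨c, rfl⟩ := tripleMk_surjective R c
  rw [← map_br, ← map_br, ← map_zero (tripleMk R), tripleMk_eq_iff, sub_zero]
  exact TwoSidedIdeal.subset_span ⟨a, b, c, rfl⟩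

/-- The left ideal spanned by products of `k` commutators of the elements `x j`. -/
def commSpan {Q : Type} [Ring Q] (x : ℕ → Q) (k : ℕ) : Ideal Q :=
  Ideal.span ((fun S : Finset ℕ => commProd x S.toList) '' {S | S.card = 2 * k})

theorem mul_mem_commSpan {Q : Type} [Ring Q] (hQ : ∀ a b c : Q, br (br a b) c = 0) {x : ℕ → Q}
    {k : ℕ} {z : Q} (hz : z ∈ commSpan x k) (r : Q) : z * r ∈ commSpan x k := by
  induction hz using Submodule.span_induction with
  | mem z hz =>
    obtain ⟨S, hS, rfl⟩ := hz
    simp only [commProd_mul_comm hQ]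
    exact Ideal.mul_mem_left _ _ (Ideal.subset_span ⟨S, hS, rfl⟩)
  | zero => simp
  | add y z _ _ hy hz => rw [add_mul]; exact add_mem hy hz
  | smul a z _ hz => rw [smul_eq_mul, mul_assoc]; exact Ideal.mul_mem_left _ _ hz

variable {K : Type} [Field K]

/-- The generic elements of the quotient of the free algebra by triple commutators. -/
def tripleVar (K : Type) [Field K] (j : ℕ) : TripleQuot (FreeAlgebra K ℕ) :=
  tripleMk _ (FreeAlgebra.ι K j)

theorem mul_commProd_mem_commSpan [Infinite K] {u : FreeAlgebra K ℕ}
    (hu : ∀ α : ℕ → K, FreeAlgebra.lift K α u = 0) {k : ℕ} {l : List ℕ} (hl : l.length = 2 * k) :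
    tripleMk _ u * commProd (tripleVar K) l ∈ commSpan (tripleVar K) (k + 1) := by
  let C : TwoSidedIdeal (FreeAlgebra K ℕ) := TwoSidedIdeal.mk'
    {c | tripleMk _ c * commProd (tripleVar K) l ∈ commSpan (tripleVar K) (k + 1)}
    (by simp)
    (fun {a b} ha hb => by
      simp only [Set.mem_ofPred_eq, map_add, add_mul] at *; exact add_mem ha hb)
    (fun {a} ha => by
      simp only [Set.mem_ofPred_eq, map_neg, neg_mul] at *; exact neg_mem ha)
    (fun {a b} hb => by
      simp only [Set.mem_ofPred_eq, map_mul, mul_assoc] at *; exact Ideal.mul_mem_left _ _ hb)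
    (fun {a b} ha => by
      simp only [Set.mem_ofPred_eq, map_mul, mul_assoc] at *
      rw [← commProd_mul_comm tripleQuot_br_br, ← mul_assoc]
      exact mul_mem_commSpan tripleQuot_br_br ha _)
  have hC : ∀ c, c ∈ C ↔ tripleMk _ c * commProd (tripleVar K) l ∈
      commSpan (tripleVar K) (k + 1) := fun c => TwoSidedIdeal.mem_mk' _ _ _ _ _ _ c
  rw [← hC]
  refine mem_of_forall_lift_eq_zero (fun i j => ?_) hu
  rw [hC, map_br]
  exact commProd_mem_span tripleQuot_br_br (tripleVar K) (l := i :: j :: l)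
    (by simp [hl, mul_add])

/-- The substitution `x_j ↦ α_j + v_j` in the Grassmann algebra. -/
noncomputable def grassEval {V : Type} [AddCommGroup V] [Module K V] (α : ℕ → K) (v : ℕ → V) :
    FreeAlgebra K ℕ →ₐ[K] ExteriorAlgebra K V :=
  FreeAlgebra.lift K fun j => algebraMap K _ (α j) + ExteriorAlgebra.ι K (v j)

theorem grassEval_mul {V : Type} [AddCommGroup V] [Module K V] (α : ℕ → K) (v : ℕ → V)
    {ω : ExteriorAlgebra K V} (hω : ∀ j, ExteriorAlgebra.ι K (v j) * ω = 0)
    (f : FreeAlgebra K ℕ) : grassEval α v f * ω = FreeAlgebra.lift K α f • ω := by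
  induction f using FreeAlgebra.induction with
  | grade0 r => simp [Algebra.smul_def]
  | grade1 j => simp [grassEval, add_mul, hω, Algebra.smul_def]
  | mul a b ha hb => rw [map_mul, mul_assoc, hb, mul_smul_comm, ha, smul_smul, map_mul, mul_comm]
  | add a b ha hb => rw [map_add, add_mul, ha, hb, map_add, add_smul]

theorem map_grassEval_commProd {V : Type} [AddCommGroup V] [Module K V] (α : ℕ → K) (v : ℕ → V)
    {k : ℕ} {l : List ℕ} (hl : l.length = 2 * k) :
    grassEval α v (commProd (FreeAlgebra.ι K) l) =
      (2 ^ k : K) • (l.map fun j => ExteriorAlgebra.ι K (v j)).prod := by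
  have h := map_commProd (grassEval α v : FreeAlgebra K ℕ →+* ExteriorAlgebra K V)
    (FreeAlgebra.ι K) l
  rw [RingHom.coe_coe] at h
  rw [h, ← commProd_algebraMap_add_ι α v k l hl]
  simp [grassEval]

theorem tripleMk_mem_commSpan_succ [CharZero K] {g : FreeAlgebra K ℕ} {m k : ℕ} (hk : k ≤ m)
    (hg : ∀ (α : ℕ → K) (v : ℕ → ℕ →₀ K),
      (∀ j, v j = 0 ∨ ∃ i < 2 * m, v j = Finsupp.single i 1) → grassEval α v g = 0)
    (h : tripleMk _ g ∈ commSpan (tripleVar K) k) :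
    tripleMk _ g ∈ commSpan (tripleVar K) (k + 1) := by
  obtain ⟨c, hc, hcg⟩ := (Finsupp.mem_span_image_iff_linearCombination _).mp h
  rw [Finsupp.linearCombination_apply, Finsupp.sum] at hcg
  obtain ⟨s, hs⟩ := (tripleMk_surjective (FreeAlgebra K ℕ)).hasRightInverse
  have hsum : tripleMk _ g =
      tripleMk _ (∑ S ∈ c.support, s (c S) * commProd (FreeAlgebra.ι K) S.toList) := by
    rw [← hcg, map_sum]
    refine Finset.sum_congr rfl fun S _ => ?_
    rw [map_mul, hs, map_commProd, smul_eq_mul]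
    rfl
  rw [← hcg]
  refine sum_mem fun S hS => ?_
  have hcard : ∀ S ∈ c.support, S.toList.length = 2 * k := fun S hS => by
    rw [Finset.length_toList]; exact hc hS
  rw [← hs (c S), smul_eq_mul]
  refine mul_commProd_mem_commSpan (fun α => ?_) (hcard S hS)
  set v : ℕ → ℕ →₀ K := fun j => if j ∈ S then Finsupp.single (S.toList.idxOf j) 1 else 0 with hv
  set ω := (S.toList.map fun j => ExteriorAlgebra.ι K (v j)).prod with hω
  have hω0 : ω ≠ 0 := map_ι_prod_ne_zero K v fun i => by
    have hi : S.toList.get i ∈ S := Finset.mem_toList.mp (List.get_mem _ _)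
    simp only [hv, if_pos hi]
    rw [List.get_eq_getElem, (Finset.nodup_toList S).idxOf_getElem]
  have hvω : ∀ j, ExteriorAlgebra.ι K (v j) * ω = 0 := fun j => by
    by_cases hj : j ∈ S
    · exact ι_mul_map_ι_prod v (Finset.mem_toList.mpr hj)
    · simp [hv, hj]
  have h1 := hg α v fun j => by
    by_cases hj : j ∈ S
    · refine Or.inr ⟨S.toList.idxOf j, ?_, by simp [hv, hj]⟩
      have := List.idxOf_lt_length_of_mem (Finset.mem_toList.mpr hj)
      rw [hcard S hS] at this
      omega
    · simp [hv, hj]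
  have h2 := map_eq_of_tripleMk_eq (exteriorAlgebra_br_br (K := K))
    (grassEval α v : FreeAlgebra K ℕ →+* ExteriorAlgebra K (ℕ →₀ K)) hsum
  rw [RingHom.coe_coe, h1, map_sum, Finset.sum_eq_single S, map_mul,
    map_grassEval_commProd α v (hcard S hS), mul_smul_comm, ← hω, grassEval_mul α v hvω,
    smul_smul] at h2
  · have h3 := (smul_eq_zero.mp h2.symm).resolve_right hω0
    exact (mul_eq_zero.mp h3).resolve_left (pow_ne_zero _ two_ne_zero)
  · intro T hT hTS
    obtain ⟨j, hjT, hjS⟩ : ∃ j ∈ T, j ∉ S := by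
      by_contra! hsub
      refine hTS (Finset.eq_of_subset_of_card_le hsub ?_)
      rw [← Finset.length_toList, ← Finset.length_toList, hcard T hT, hcard S hS]
    rw [map_mul, map_grassEval_commProd α v (hcard T hT), List.prod_eq_zero, smul_zero, mul_zero]
    exact List.mem_map.mpr ⟨j, Finset.mem_toList.mpr hjT, by simp [hv, hjS]⟩
  · exact fun hS' => absurd hS hS'

/-- The identities of the Grassmann algebra of a space of dimension `2 * m` follow from
`[x₁, x₂, x₃]` and `[x₁, x₂]⋯[x_{2m+1}, x_{2m+2}]`. -/
theorem mem_of_forall_grassEval_eq_zero [CharZero K] {g : FreeAlgebra K ℕ} {m : ℕ}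
    {J : TwoSidedIdeal (FreeAlgebra K ℕ)} (hJ : ∀ a b c, br (br a b) c ∈ J)
    (hJm : ∀ l : List ℕ, l.length = 2 * (m + 1) → commProd (FreeAlgebra.ι K) l ∈ J)
    (hg : ∀ (α : ℕ → K) (v : ℕ → ℕ →₀ K),
      (∀ j, v j = 0 ∨ ∃ i < 2 * m, v j = Finsupp.single i 1) → grassEval α v g = 0) :
    g ∈ J := by
  have hD : ∀ a b, tripleMk _ a = tripleMk _ b → b ∈ J → a ∈ J := fun a b h hb => by
    simpa using J.add_mem (tripleIdeal_le hJ (tripleMk_eq_iff.mp h)) hb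
  have h : ∀ k ≤ m + 1, tripleMk _ g ∈ commSpan (tripleVar K) k := by
    intro k
    induction k with
    | zero =>
      intro _
      rw [← mul_one (tripleMk _ g)]
      exact Ideal.mul_mem_left _ _ (Ideal.subset_span ⟨∅, by simp, by simp [commProd]⟩)
    | succ k ih =>
      exact fun hk => tripleMk_mem_commSpan_succ (by omega) hg (ih (by omega))
  suffices H : ∀ z ∈ commSpan (tripleVar K) (m + 1), ∀ f, tripleMk _ f = z → f ∈ J from
    H _ (h _ le_rfl) _ rfl
  intro z hz
  induction hz using Submodule.span_induction with
  | mem z hz =>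
    obtain ⟨S, hS, rfl⟩ := hz
    intro f hf
    refine hD f (commProd (FreeAlgebra.ι K) S.toList) ?_ (hJm _ (by simpa using hS))
    rw [hf, map_commProd]
    rfl
  | zero => exact fun f hf => hD f 0 (by rw [hf, map_zero]) J.zero_mem
  | add y z _ _ hy hz =>
    intro f hf
    obtain ⟨y, rfl⟩ := tripleMk_surjective _ y
    obtain ⟨z, rfl⟩ := tripleMk_surjective _ z
    exact hD f (y + z) (by rw [hf, map_add]) (J.add_mem (hy _ rfl) (hz _ rfl))
  | smul a z _ hz =>
    intro f hf
    obtain ⟨a, rfl⟩ := tripleMk_surjective _ a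
    obtain ⟨z, rfl⟩ := tripleMk_surjective _ z
    exact hD f (a * z) (by rw [hf, map_mul, smul_eq_mul]) (J.mul_mem_left _ _ (hz _ rfl))

end GrassmannIdentities

section RelativelyFree

variable {K : Type} [Field K]

theorem mem_TId_relFree_iff {R : Type} [Ring R] [Algebra K R] {n : ℕ} {f : FreeAlgebra K ℕ} :
    f ∈ TId K (RelFree K R n) ↔ ∀ (φ : FreeAlgebra K ℕ →ₐ[K] FreeAlgebra K (Fin n))
      (ψ : FreeAlgebra K (Fin n) →ₐ[K] R), ψ (φ f) = 0 := by
  set π := RingQuot.mkAlgHom K fun f g : FreeAlgebra K (Fin n) => IsPI K R (f - g) with hπ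
  constructor
  · intro hf φ ψ
    have hψ : ∀ ⦃x y : FreeAlgebra K (Fin n)⦄, IsPI K R (x - y) → ψ x = ψ y :=
      fun x y h => by simpa [sub_eq_zero] using h ψ
    rw [← RingQuot.liftAlgHom_mkAlgHom_apply (S := K) ψ hψ (φ f)]
    have h := hf (π.comp φ)
    rw [AlgHom.comp_apply] at h
    rw [h, map_zero]
  · intro hf φ
    choose p hp using fun j => RingQuot.mkAlgHom_surjective K
      (fun f g : FreeAlgebra K (Fin n) => IsPI K R (f - g)) (φ (FreeAlgebra.ι K j))
    have h : φ = π.comp (FreeAlgebra.lift K p) := by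
      ext j
      simp [hπ, hp]
    rw [h, AlgHom.comp_apply, ← map_zero π]
    refine RingQuot.mkAlgHom_rel K ?_
    rw [sub_zero]
    exact hf _

theorem br_mem_of_forall {X S : Type} [Ring S] [Algebra K S]
    (hS : ∀ a b c : S, br (br a b) c = 0) (ρ : FreeAlgebra K X →ₐ[K] S) {I : Ideal S} {a : S}
    (h : ∀ i, br a (ρ (FreeAlgebra.ι K i)) ∈ I) (q : FreeAlgebra K X) : br a (ρ q) ∈ I := by
  induction q using FreeAlgebra.induction with
  | grade0 r => simp [br, Algebra.commutes]
  | grade1 j => exact h j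
  | mul p q hp hq =>
    have : br a (ρ (p * q)) = ρ q * br a (ρ p) + ρ p * br a (ρ q) := by
      rw [← br_comm_mul hS, map_mul]
      simp only [br]
      noncomm_ring
    rw [this]
    exact add_mem (I.mul_mem_left _ hp) (I.mul_mem_left _ hq)
  | add p q hp hq =>
    have : br a (ρ (p + q)) = br a (ρ p) + br a (ρ q) := by
      rw [map_add]
      simp only [br]
      noncomm_ring
    rw [this]
    exact add_mem hp hq

theorem br_swap {S : Type} [Ring S] (a b : S) : br a b = -br b a := by
  simp [br]

theorem br_map_mem_span {X S : Type} [Ring S] [Algebra K S]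
    (hS : ∀ a b c : S, br (br a b) c = 0) (ρ : FreeAlgebra K X →ₐ[K] S) (p q : FreeAlgebra K X) :
    br (ρ p) (ρ q) ∈ Ideal.span
      {z | ∃ i j, z = br (ρ (FreeAlgebra.ι K i)) (ρ (FreeAlgebra.ι K j))} := by
  refine br_mem_of_forall hS ρ (fun j => ?_) q
  rw [br_swap]
  refine neg_mem (br_mem_of_forall hS ρ (fun i => ?_) p)
  exact Ideal.subset_span ⟨j, i, rfl⟩

theorem prod_br_map_mem_span {X S : Type} [Ring S] [Algebra K S]
    (hS : ∀ a b c : S, br (br a b) c = 0) (ρ : FreeAlgebra K X →ₐ[K] S)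
    (p q : ℕ → FreeAlgebra K X) (L : List ℕ) :
    (L.map fun i => br (ρ (p i)) (ρ (q i))).prod ∈ Ideal.span
      {z | ∃ l : List X, l.length = 2 * L.length ∧ z = commProd (fun i => ρ (FreeAlgebra.ι K i)) l} := by
  induction L with
  | nil => exact Ideal.subset_span ⟨[], by simp [commProd]⟩
  | cons t L ih =>
    rw [List.map_cons, List.prod_cons]
    have hw := br_map_mem_span hS ρ (p t) (q t)
    generalize br (ρ (p t)) (ρ (q t)) = w at hw ⊢
    generalize (L.map fun i => br (ρ (p i)) (ρ (q i))).prod = u at ih ⊢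
    induction hw using Submodule.span_induction with
    | zero => simp
    | add y z _ _ hy hz => rw [add_mul]; exact add_mem hy hz
    | smul a z _ hz => rw [smul_eq_mul, mul_assoc]; exact Ideal.mul_mem_left _ _ hz
    | mem y hy =>
      obtain ⟨i, j, rfl⟩ := hy
      induction ih using Submodule.span_induction with
      | zero => simp
      | add y z _ _ hy hz => rw [mul_add]; exact add_mem hy hz
      | smul a z _ hz =>
        rw [smul_eq_mul, ← mul_assoc, br_comm_mul hS, mul_assoc]
        exact Ideal.mul_mem_left _ _ hz
      | mem z hz =>
        obtain ⟨l, hl, rfl⟩ := hz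
        exact Ideal.subset_span ⟨i :: j :: l, by simp [hl, mul_add], rfl⟩

theorem prod_br_map_eq_zero {X S : Type} [Fintype X] [Ring S] [Algebra K S]
    (hS : ∀ a b c : S, br (br a b) c = 0) (ρ : FreeAlgebra K X →ₐ[K] S)
    (p q : ℕ → FreeAlgebra K X) {L : List ℕ} (hL : Fintype.card X < 2 * L.length) :
    (L.map fun i => br (ρ (p i)) (ρ (q i))).prod = 0 := by
  have h := prod_br_map_mem_span hS ρ p q L
  rwa [Ideal.span_eq_bot.mpr, Ideal.mem_bot] at h
  rintro _ ⟨l, hl, rfl⟩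
  refine commProd_eq_zero_of_not_nodup hS _ fun hn => ?_
  have := hn.length_le_card
  omega

section CornerHom

variable {V : Type} [AddCommGroup V] [Module K V]

/-- The right bottom corner of the matrices in `algA`. -/
noncomputable def algACorner (K V : Type) [Field K] [AddCommGroup V] [Module K V] :
    algA K V →ₐ[K] ExteriorAlgebra K V where
  toFun M := M.1 1 1
  map_one' := by simp
  map_zero' := by simp
  map_add' := by simp
  map_mul' M N := by simp [Matrix.mul_apply, Fin.sum_univ_two, M.2.2]
  commutes' r := by simp [Matrix.algebraMap_matrix_apply]

theorem algA_mul_apply (M N : algA K V) : (M * N).1 0 0 = M.1 0 0 * N.1 0 0 := by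
  simp [Matrix.mul_apply, Fin.sum_univ_two, N.2.2]

theorem algA_br_apply (M N : algA K V) : (br M N).1 0 0 = 0 := by
  have h : (br M N).1 0 0 = (M * N).1 0 0 - (N * M).1 0 0 := rfl
  rw [h, algA_mul_apply, algA_mul_apply, mul_comm_of_mem_evenPart M.2.1, sub_self]

theorem algA_mul_eq_zero {M N : algA K V} (hM : M.1 0 0 = 0) (hN : N.1 0 0 = 0)
    (hN' : algACorner K V N = 0) : M * N = 0 := by
  have hN₁ : N.1 1 1 = 0 := hN'
  ext i j
  fin_cases i <;> fin_cases j <;>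
    simp [Matrix.mul_apply, Fin.sum_univ_two, N.2.2, M.2.2, hM, hN, hN₁]

end CornerHom

theorem map_chainProd {R : Type} [Ring R] [Algebra K R] (φ : FreeAlgebra K ℕ →ₐ[K] R) (k : ℕ) :
    φ (chainProd K k) =
      ((List.range k).map fun i => br (φ (xv K (2 * i + 1))) (φ (xv K (2 * i + 2)))).prod := by
  simp [chainProd, map_list_prod, br, Function.comp_def]

theorem br_mul_br_br_mem_TId [CharZero K] (n : ℕ) :
    br (xv K 1) (xv K 2) * br (br (xv K 3) (xv K 4)) (xv K 5) ∈
      TId K (RelFree K (algA K (ℕ →₀ K)) n) := by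
  rw [mem_TId_relFree_iff]
  intro φ ψ
  have h : ∀ a b, ψ (φ (br a b)) = br (ψ (φ a)) (ψ (φ b)) := fun a b => by simp [br]
  rw [map_mul, map_mul, h, h, h]
  refine algA_mul_eq_zero (algA_br_apply _ _) (algA_br_apply _ _) ?_
  have h' : ∀ a b, algACorner K (ℕ →₀ K) (br a b) = br (algACorner K _ a) (algACorner K _ b) :=
    fun a b => by simp [br]
  rw [h', h', exteriorAlgebra_br_br]

theorem chainProd_mem_TId [CharZero K] {n m : ℕ} (hn : n < 2 * (m + 1)) :
    chainProd K (m + 2) ∈ TId K (RelFree K (algA K (ℕ →₀ K)) n) := by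
  rw [mem_TId_relFree_iff]
  intro φ ψ
  have h := map_chainProd (ψ.comp φ) (m + 2)
  rw [AlgHom.comp_apply] at h
  rw [h, List.range_succ_eq_map, List.map_cons, List.prod_cons]
  refine algA_mul_eq_zero (algA_br_apply _ _) ?_ ?_
  · rw [List.range_succ_eq_map, List.map_cons, List.map_cons, List.prod_cons, algA_mul_apply,
      algA_br_apply, zero_mul]
  · have h' : ∀ a b, algACorner K (ℕ →₀ K) (br a b) = br (algACorner K _ a) (algACorner K _ b) :=
      fun a b => by simp [br]
    rw [List.map_map, map_list_prod, List.map_map]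
    have := prod_br_map_eq_zero exteriorAlgebra_br_br ((algACorner K (ℕ →₀ K)).comp ψ)
      (fun i => φ (xv K (2 * (i + 1) + 1))) (fun i => φ (xv K (2 * (i + 1) + 2)))
      (L := List.range (m + 1)) (by simpa using hn)
    simpa [Function.comp_def, h'] using this

/-- The identities of an algebra form a two-sided ideal. -/
noncomputable def tIdIdeal (K : Type) [Field K] (R : Type) [Ring R] [Algebra K R] :
    TwoSidedIdeal (FreeAlgebra K ℕ) :=
  TwoSidedIdeal.mk' (TId K R) (fun φ => map_zero φ)
    (fun {a b} ha hb φ => by rw [map_add, ha φ, hb φ, add_zero])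
    (fun {a} ha φ => by rw [map_neg, ha φ, neg_zero])
    (fun {a b} hb φ => by rw [map_mul, hb φ, mul_zero])
    (fun {a b} ha φ => by rw [map_mul, ha φ, zero_mul])

theorem TIdealGen_subset_TId {R : Type} [Ring R] [Algebra K R] {F : Set (FreeAlgebra K ℕ)}
    (hF : F ⊆ TId K R) : TIdealGen K F ⊆ TId K R := by
  have h : ∀ f, f ∈ tIdIdeal K R ↔ f ∈ TId K R := fun f => TwoSidedIdeal.mem_mk' _ _ _ _ _ _ f
  intro f hf
  refine (h f).mp (hf _ (fun φ g hg => ?_) fun g hg => (h g).mpr (hF hg))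
  rw [h] at hg ⊢
  exact fun χ => hg (χ.comp φ)

theorem triEval_eq_zero_of_mem_TId {n : ℕ} (hn : 2 ≤ n) {f : FreeAlgebra K ℕ}
    (hf : f ∈ TId K (RelFree K (algA K (ℕ →₀ K)) n)) (α τ γ : ℕ → K) {v : ℕ → ℕ →₀ K}
    (hv : ∀ j, v j = 0 ∨ ∃ i < n, v j = Finsupp.single i 1) :
    triEval K α τ (fun j => algebraMap K _ (γ j) + ExteriorAlgebra.ι K (v j)) f = 0 := by
  rw [mem_TId_relFree_iff] at hf
  let e : ℕ → Einf K := fun i => ExteriorAlgebra.ι K (Finsupp.single i 1)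
  let c : ℕ → K := fun i => if i = 0 then 1 else 0
  let d : ℕ → K := fun i => if i = 1 then 1 else 0
  let y : Fin n → algA K (ℕ →₀ K) := fun i =>
    ⟨!![algebraMap K _ (c i), algebraMap K _ (d i); 0, e i],
      SetLike.algebraMap_mem_graded (CliffordAlgebra.evenOdd (0 : QuadraticForm K (ℕ →₀ K))) _, rfl⟩
  let ψ := FreeAlgebra.lift K y
  let P := ((algA K (ℕ →₀ K)).val.comp ψ).range
  have hy : ∀ i < n, !![algebraMap K _ (c i), algebraMap K _ (d i); 0, e i] ∈ P := fun i hi =>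
    ⟨FreeAlgebra.ι K ⟨i, hi⟩, by simp [ψ, y]⟩
  have h0 := hy 0 (by omega)
  have h1 := hy 1 (by omega)
  have hee : ∀ i, e i * e i = 0 := fun i => ExteriorAlgebra.ι_sq_zero _
  have hE : !![1, 0; 0, 0] ∈ P := by
    convert P.mul_mem h0 h0 using 1
    simp [c, d, hee]
  have hE₁ : !![0, 1; 0, 0] ∈ P := by
    convert P.mul_mem hE h1 using 1
    simp [c, d]
  have hE₂ : !![0, 0; 0, 1] ∈ P := by
    convert P.sub_mem P.one_mem hE using 1
    simp [Matrix.one_fin_two]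
  have he : ∀ i < n, !![0, 0; 0, e i] ∈ P := by
    intro i hi
    convert P.sub_mem (P.sub_mem (hy i hi) (P.smul_mem hE (c i))) (P.smul_mem hE₁ (d i)) using 1
    simp [Algebra.algebraMap_eq_smul_one]
  have hM : ∀ j, !![algebraMap K _ (α j), algebraMap K _ (τ j);
      0, algebraMap K (Einf K) (γ j) + ExteriorAlgebra.ι K (v j)] ∈ P := by
    intro j
    have hw : !![0, 0; 0, ExteriorAlgebra.ι K (v j)] ∈ P := by
      rcases hv j with h | ⟨i, hi, h⟩
      · rw [h, map_zero]
        convert P.zero_mem using 1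
        exact Matrix.eta_fin_two 0 |>.symm
      · rw [h]
        exact he i hi
    convert P.add_mem (P.add_mem (P.add_mem (P.smul_mem hE (α j)) (P.smul_mem hE₁ (τ j)))
      (P.smul_mem hE₂ (γ j))) hw using 1
    simp [Algebra.algebraMap_eq_smul_one]
  choose p hp using hM
  have h : triEval K α τ (fun j => algebraMap K _ (γ j) + ExteriorAlgebra.ι K (v j)) =
      ((algA K (ℕ →₀ K)).val.comp ψ).comp (FreeAlgebra.lift K p) := by
    ext j : 2
    rw [Function.comp_apply, triEval_ι, ← hp]
    simp
  rw [h, AlgHom.comp_apply, AlgHom.comp_apply, hf, map_zero]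

theorem mem_of_mem_TId_relFree [CharZero K] {m : ℕ} (hm : 1 ≤ m)
    {I : TwoSidedIdeal (FreeAlgebra K ℕ)} (hI : ∀ a b c d e, br a b * br (br c d) e ∈ I)
    (hIm : ∀ a b : ℕ → FreeAlgebra K ℕ, ((List.range (m + 2)).map fun i => br (a i) (b i)).prod ∈ I)
    {f : FreeAlgebra K ℕ} (hf : f ∈ TId K (RelFree K (algA K (ℕ →₀ K)) (2 * m))) : f ∈ I := by
  let J : TwoSidedIdeal (FreeAlgebra K ℕ) := TwoSidedIdeal.mk' {d | ∀ a b, br a b * d ∈ I}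
    (fun a b => by rw [mul_zero]; exact I.zero_mem)
    (fun {x y} hx hy a b => by rw [mul_add]; exact I.add_mem (hx a b) (hy a b))
    (fun {x} hx a b => by rw [mul_neg]; exact I.neg_mem (hx a b))
    (fun {r d} hd a b => by
      have : br a b * (r * d) = br a (b * r) * d - b * (br a r * d) := by
        simp only [br]
        noncomm_ring
      rw [this]
      exact I.sub_mem (hd _ _) (I.mul_mem_left _ _ (hd _ _)))
    (fun {d r} hd a b => by rw [← mul_assoc]; exact I.mul_mem_right _ _ (hd a b))
  have hJ : ∀ d, d ∈ J ↔ ∀ a b, br a b * d ∈ I := fun d => TwoSidedIdeal.mem_mk' _ _ _ _ _ _ d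
  let C : TwoSidedIdeal (FreeAlgebra K ℕ) := TwoSidedIdeal.mk' {c | ∀ d ∈ J, c * d ∈ I}
    (fun d _ => by rw [zero_mul]; exact I.zero_mem)
    (fun {x y} hx hy d hd => by rw [add_mul]; exact I.add_mem (hx d hd) (hy d hd))
    (fun {x} hx d hd => by rw [neg_mul]; exact I.neg_mem (hx d hd))
    (fun {r c} hc d hd => by rw [mul_assoc]; exact I.mul_mem_left _ _ (hc d hd))
    (fun {c r} hc d hd => by rw [mul_assoc]; exact hc _ (J.mul_mem_left _ _ hd))
  have hC : ∀ c, c ∈ C ↔ ∀ d ∈ J, c * d ∈ I := fun c => TwoSidedIdeal.mem_mk' _ _ _ _ _ _ c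
  refine mem_of_forall_triEval_eq_zero (S := Einf K) (J := J)
    (G := {g | ∃ (γ : ℕ → K) (v : ℕ → ℕ →₀ K),
      (∀ j, v j = 0 ∨ ∃ i < 2 * m, v j = Finsupp.single i 1) ∧
        g = fun j => algebraMap K _ (γ j) + ExteriorAlgebra.ι K (v j)})
    ?_ ⟨_, 0, 0, fun _ => Or.inl rfl, rfl⟩ (fun h hh => ?_) (fun d hd M i => ?_)
  · rintro _ ⟨γ, v, hv, rfl⟩ α τ
    exact triEval_eq_zero_of_mem_TId (by omega) hf α τ γ hv
  · refine mem_of_forall_grassEval_eq_zero (m := m) (fun a b c => ?_) (fun l hl => ?_)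
      fun α v hv => hh _ ⟨α, v, hv, rfl⟩
    · rw [hJ]
      exact fun _ _ => hI _ _ _ _ _
    · rw [hJ]
      intro a b
      obtain ⟨a', b', h⟩ := exists_commProd_eq_range_prod (FreeAlgebra.ι K) (m + 1) l hl
      have := hIm (fun i => Nat.casesOn i a a') (fun i => Nat.casesOn i b b')
      rw [List.range_succ_eq_map] at this
      rw [h]
      simpa [Function.comp_def] using this
  · refine (hC _).mp (wordOf_mul_sub_mem (fun i j => ?_) M i) d hd
    rw [hC]
    exact fun d hd => (hJ d).mp hd _ _

end RelativelyFree

/-- For even `n ≥ 2`, the T-ideal of identities of the relatively free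
algebra `F_n(A)` is generated as a T-ideal by `[x₁,x₂][x₃,x₄,x₅]` and
`[x₁,x₂][x₃,x₄]⋯[x_{n+3},x_{n+4}]`. -/
theorem tideal_relfree_algA_eq_gen (K : Type) [Field K] [CharZero K]
    (n : ℕ) (hn : 2 ≤ n) (hne : Even n) :
    TId K (RelFree K (↥(algA K (ℕ →₀ K))) n) =
      TIdealGen K {br (xv K 1) (xv K 2) * br (br (xv K 3) (xv K 4)) (xv K 5),
        chainProd K ((n + 4) / 2)} := by
  obtain ⟨m, rfl⟩ := hne
  have hm : (m + m + 4) / 2 = m + 2 := by omega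
  rw [hm]
  refine Set.Subset.antisymm (fun f hf I hI hgen => ?_) (TIdealGen_subset_TId ?_)
  · have h1 : _ ∈ I := hgen (Set.mem_insert _ _)
    have h2 : _ ∈ I := hgen (Set.mem_insert_of_mem _ rfl)
    rw [← two_mul] at hf
    refine mem_of_mem_TId_relFree (by omega) (fun a b c d e => ?_) (fun a b => ?_) hf
    · have h := hI (FreeAlgebra.lift K fun j => if j = 1 then a else if j = 2 then b else
        if j = 3 then c else if j = 4 then d else e) _ h1
      simpa [br, xv] using h
    · have h := hI (FreeAlgebra.lift K fun j =>
        if j % 2 = 1 then a ((j - 1) / 2) else b ((j - 2) / 2)) _ h2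
      rw [map_chainProd] at h
      simpa [xv] using h
  · rintro _ (rfl | rfl)
    · exact br_mul_br_br_mem_TId _
    · exact chainProd_mem_TId (by omega)
end

section
/- Let n ≥ 1 and let u₀,…,u_{n+1}, v₁, v₂, w₁,…,w_{2n} be arbitrary elements of K⟨X⟩, and let σ be a permutation of {1,…,2n}. Then the difference f − sgn(σ)·u₀[v₁,v₂][w₁,w₂]⋯[w_{2n−1},w_{2n}]u₁u₂⋯u_{n+1} lies in T(A), where f = u₀[v₁,v₂]u₁[w_{σ(1)},w_{σ(2)}]u₂[w_{σ(3)},w_{σ(4)}]⋯u_n[w_{σ(2n−1)},w_{σ(2n)}]u_{n+1}. -/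
/-- Reindexing a product of pairwise anticommuting elements by a permutation multiplies it
by the sign of the permutation. -/
theorem prod_ofFn_comp_perm_of_anticomm {R : Type*} [Ring R] {m : ℕ} (σ : Equiv.Perm (Fin m))
    (x : Fin m → R) (hx : ∀ i j, x i * x j = -(x j * x i)) :
    (List.ofFn fun i => x (σ i)).prod = (Equiv.Perm.sign σ : ℤ) • (List.ofFn x).prod := by
  have swap_adj : ∀ (m : ℕ) (i : Fin m) (y : Fin (m + 1) → R),
      (∀ i j, y i * y j = -(y j * y i)) →
      (List.ofFn fun k => y (Equiv.swap i.castSucc i.succ k)).prod = -(List.ofFn y).prod := by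
    intro m
    induction m with
    | zero => exact fun i => i.elim0
    | succ m ih =>
      intro i y hy
      induction i using Fin.cases with
      | zero =>
        have h (k : Fin m) : Equiv.swap (0 : Fin (m + 2)) 1 k.succ.succ = k.succ.succ :=
          Equiv.swap_apply_of_ne_of_ne (Fin.succ_ne_zero _)
            (fun h => Fin.succ_ne_zero k (Fin.succ_injective _ h))
        simp [List.ofFn_succ, h, ← mul_assoc, hy 1 0]
      | succ i =>
        have h (k : Fin (m + 1)) : Equiv.swap i.succ.castSucc i.succ.succ k.succ =
            (Equiv.swap i.castSucc i.succ k).succ := by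
          rw [← Fin.succ_castSucc]
          exact ((Fin.succ_injective _).swap_apply _ _ _)
        have h0 : Equiv.swap i.succ.castSucc i.succ.succ 0 = 0 :=
          Equiv.swap_apply_of_ne_of_ne (by simp [Fin.ext_iff]) (Fin.succ_ne_zero _).symm
        rw [List.ofFn_succ, List.ofFn_succ (f := y), List.prod_cons, List.prod_cons, h0]
        simp only [h]
        rw [ih i (fun k => y k.succ) (fun _ _ => hy _ _), mul_neg]
  cases m with
  | zero => simp [Subsingleton.elim σ 1]
  | succ m =>
    have hσ : σ ∈ Submonoid.closure
        (Set.range fun i : Fin m => Equiv.swap i.castSucc i.succ) := by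
      rw [Equiv.Perm.mclosure_swap_castSucc_succ]; trivial
    induction hσ using Submonoid.closure_induction generalizing x with
    | mem τ hτ =>
      obtain ⟨i, rfl⟩ := hτ
      rw [swap_adj m i x hx, Equiv.Perm.sign_swap (by simp [Fin.ext_iff])]
      simp
    | one => simp
    | mul τ ρ _ _ hτ hρ =>
      simp only [Equiv.Perm.mul_apply]
      rw [hρ (fun k => x (τ k)) (fun _ _ => hx _ _), hτ x hx, smul_smul, Equiv.Perm.sign_mul,
        mul_comm]
      simp

/-- A product over pairs of consecutive indices is the full product. -/
theorem prod_ofFn_pairs {R : Type*} [Monoid R] (n : ℕ) (x : Fin (2 * n) → R) :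
    (List.ofFn fun i : Fin n => x ⟨2 * i.1, by omega⟩ * x ⟨2 * i.1 + 1, by omega⟩).prod =
      (List.ofFn x).prod := by
  rw [List.ofFn_mul', List.prod_flatten, List.map_ofFn]
  congr 2
  funext i
  simp [List.ofFn_succ]

/-- Central factors interlaced in a product can be collected at the front. -/
theorem prod_ofFn_mul_central {R : Type*} [Monoid R] (n : ℕ) (u : Fin (n + 1) → R)
    (c : Fin n → R) (hc : ∀ i r, Commute (c i) r) :
    (List.ofFn fun i : Fin n => u i.castSucc * c i).prod * u (Fin.last n) =
      (List.ofFn c).prod * (List.ofFn u).prod := by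
  induction n with
  | zero => simp
  | succ n ih =>
    have h := ih (fun i => u i.succ) (fun i => c i.succ) (fun _ => hc _)
    rw [List.ofFn_succ, List.ofFn_succ (f := c), List.ofFn_succ (f := u)]
    simp only [List.prod_cons, Fin.castSucc_zero, ← Fin.succ_castSucc]
    rw [← Fin.succ_last, mul_assoc, h, ← (hc 0 (u 0)).eq, mul_assoc, mul_assoc, ← mul_assoc (u 0),
      ← mul_assoc _ (u 0)]
    congr 2
    refine (Commute.list_prod_right _ _ fun y hy => ?_).eq
    obtain ⟨i, rfl⟩ := (List.mem_ofFn' _ _).1 hy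
    exact (hc _ _).symm

/-- Factors of `2` can be pulled out of a product. -/
theorem prod_ofFn_two_mul {R : Type*} [Semiring R] (n : ℕ) (y : Fin n → R) :
    (List.ofFn fun i => 2 * y i).prod = 2 ^ n * (List.ofFn y).prod := by
  induction n with
  | zero => simp
  | succ n ih =>
    rw [List.ofFn_succ, List.prod_cons, ih, List.ofFn_succ (f := y), List.prod_cons, pow_succ',
      mul_assoc, mul_assoc, ← mul_assoc (y 0), ← mul_assoc _ (y 0),
      ((Commute.ofNat_right (y 0) 2).pow_right n).eq]

section Grassmann

variable {K V : Type} [Field K] [AddCommGroup V] [Module K V]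

theorem mul_comm_of_mem_evenOdd {i j : ZMod 2} {a b : ExteriorAlgebra K V}
    (ha : a ∈ CliffordAlgebra.evenOdd (0 : QuadraticForm K V) i)
    (hb : b ∈ CliffordAlgebra.evenOdd (0 : QuadraticForm K V) j) :
    a * b = (-1 : ℤˣ) ^ (j * i) • (b * a) := by
  have h := CliffordAlgebra.map_mul_map_of_isOrtho_of_mem_evenOdd
    (Q₁ := (0 : QuadraticForm K V)) (Q₂ := (0 : QuadraticForm K V))
    (Qₙ := (0 : QuadraticForm K V)) (.id _) (.id _) (fun _ _ => by simp [QuadraticMap.IsOrtho])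
    a b ha hb
  simpa [CliffordAlgebra.map_id] using h

theorem oddPart_anticomm {a b : ExteriorAlgebra K V} (ha : a ∈ oddPart K V)
    (hb : b ∈ oddPart K V) : a * b = -(b * a) := by
  simpa using mul_comm_of_mem_evenOdd ha hb

theorem exists_even_add_odd (a : ExteriorAlgebra K V) :
    ∃ p ∈ evenPart K V, ∃ q ∈ oddPart K V, p + q = a := by
  have h := (CliffordAlgebra.evenOdd_isCompl (0 : QuadraticForm K V)).sup_eq_top
  exact Submodule.mem_sup.1 (h ▸ Submodule.mem_top : a ∈ _)

theorem evenPart_commute {a : ExteriorAlgebra K V} (ha : a ∈ evenPart K V)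
    (b : ExteriorAlgebra K V) : Commute a b := by
  obtain ⟨p, hp, q, hq, rfl⟩ := exists_even_add_odd b
  refine Commute.add_right ?_ ?_
  · simpa [commute_iff_eq] using mul_comm_of_mem_evenOdd ha hp
  · simpa [commute_iff_eq] using mul_comm_of_mem_evenOdd ha hq

theorem br_even_add_odd {p q p' q' : ExteriorAlgebra K V} (hp : p ∈ evenPart K V)
    (hq : q ∈ oddPart K V) (hp' : p' ∈ evenPart K V) (hq' : q' ∈ oddPart K V) :
    br (p + q) (p' + q') = 2 * (q * q') := by
  have h1 := (evenPart_commute hp p').eq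
  have h2 := (evenPart_commute hp q').eq
  have h3 := (evenPart_commute hp' q).eq
  have h4 := oddPart_anticomm hq' hq
  simp only [br, mul_add, add_mul, h1, h2, h3, h4, two_mul]
  abel

/-- In the Grassmann algebra, permuting the entries of a product of commutators interlaced with
arbitrary factors multiplies it by the sign, and the commutators can be collected in front. -/
theorem grassmann_prod_br_perm (n : ℕ) (u : Fin (n + 1) → ExteriorAlgebra K V)
    (w : Fin (2 * n) → ExteriorAlgebra K V) (σ : Equiv.Perm (Fin (2 * n))) :
    (List.ofFn fun i : Fin n => u i.castSucc *
        br (w (σ ⟨2 * i.1, by omega⟩)) (w (σ ⟨2 * i.1 + 1, by omega⟩))).prod * u (Fin.last n) =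
      (Equiv.Perm.sign σ : ℤ) •
        ((List.ofFn fun i : Fin n =>
            br (w ⟨2 * i.1, by omega⟩) (w ⟨2 * i.1 + 1, by omega⟩)).prod *
          (List.ofFn u).prod) := by
  choose p hp q hq hpq using fun i => exists_even_add_odd (w i)
  have hbr (i j) : br (w i) (w j) = 2 * (q i * q j) := by
    rw [← hpq i, ← hpq j, br_even_add_odd (hp i) (hq i) (hp j) (hq j)]
  have hcomm (i j) (r : ExteriorAlgebra K V) : Commute (br (w i) (w j)) r := by
    have hij : q i * q j ∈ evenPart K V := by
      simpa [evenPart, CharTwo.add_self_eq_zero] using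
        CliffordAlgebra.evenOdd_mul_le (Q := (0 : QuadraticForm K V)) 1 1
          (Submodule.mul_mem_mul (hq i) (hq j))
    rw [hbr]
    exact (Commute.ofNat_left 2 r).mul_left (evenPart_commute hij r)
  rw [prod_ofFn_mul_central n u _ (fun i r => hcomm _ _ r)]
  simp only [hbr]
  rw [prod_ofFn_two_mul n fun i : Fin n => q (σ ⟨2 * i.1, _⟩) * q (σ ⟨2 * i.1 + 1, _⟩),
    prod_ofFn_two_mul n fun i : Fin n => q ⟨2 * i.1, _⟩ * q ⟨2 * i.1 + 1, _⟩,
    prod_ofFn_pairs n q, prod_ofFn_pairs n fun i => q (σ i), prod_ofFn_comp_perm_of_anticomm σ q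
    (fun i j => oddPart_anticomm (hq i) (hq j)), mul_smul_comm, smul_mul_assoc]

/-- The `(2,2)` entry as a ring homomorphism on `algA`. -/
def algALowerEntry (K V : Type) [Field K] [AddCommGroup V] [Module K V] :
    ↥(algA K V) →+* ExteriorAlgebra K V where
  toFun M := M.1 1 1
  map_one' := by simp
  map_zero' := by simp
  map_add' M N := by simp
  map_mul' M N := by
    have h : M.1 1 0 = 0 := M.2.2
    simp [Matrix.mul_apply, Fin.sum_univ_two, h]

theorem algA_mul_br_mul_eq_zero (a b c d : ↥(algA K V)) (hd : algALowerEntry K V d = 0) :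
    a * br b c * d = 0 := by
  have ha : a.1 1 0 = 0 := a.2.2
  have hb : b.1 1 0 = 0 := b.2.2
  have hc : c.1 1 0 = 0 := c.2.2
  have hd0 : d.1 1 0 = 0 := d.2.2
  have hd1 : d.1 1 1 = 0 := hd
  have hbc : b.1 0 0 * c.1 0 0 = c.1 0 0 * b.1 0 0 := (evenPart_commute b.2.1 _).eq
  apply Subtype.ext
  ext i j
  fin_cases i <;> fin_cases j <;>
    simp [br, Matrix.mul_apply, Fin.sum_univ_two, ha, hb, hc, hd0, hd1, hbc]

end Grassmann

/-- For `n ≥ 1`, arbitrary `u₀, …, u_{n+1}, v₁, v₂, w₁, …, w_{2n} ∈ K⟨X⟩`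
and a permutation `σ` of `{1, …, 2n}`, the difference
`u₀[v₁,v₂]u₁[w_{σ(1)},w_{σ(2)}]u₂⋯uₙ[w_{σ(2n-1)},w_{σ(2n)}]u_{n+1}
  - sgn(σ)·u₀[v₁,v₂][w₁,w₂]⋯[w_{2n-1},w_{2n}]u₁u₂⋯u_{n+1}`
is a polynomial identity of `A`. -/
theorem swap_commutators_mod_TA (K : Type) [Field K] [CharZero K] (n : ℕ) (hn : 1 ≤ n)
    (u : Fin (n + 2) → FreeAlgebra K ℕ) (v₁ v₂ : FreeAlgebra K ℕ)
    (w : Fin (2 * n) → FreeAlgebra K ℕ) (σ : Equiv.Perm (Fin (2 * n))) :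
    (u 0 * br v₁ v₂ *
        (List.ofFn fun i : Fin n =>
          u ⟨i.1 + 1, by omega⟩ *
            br (w (σ ⟨2 * i.1, by have := i.2; omega⟩))
               (w (σ ⟨2 * i.1 + 1, by have := i.2; omega⟩))).prod *
        u ⟨n + 1, by omega⟩) -
      (Equiv.Perm.sign σ : ℤ) •
        (u 0 * br v₁ v₂ *
          (List.ofFn fun i : Fin n =>
            br (w ⟨2 * i.1, by have := i.2; omega⟩)
               (w ⟨2 * i.1 + 1, by have := i.2; omega⟩)).prod *
          (List.ofFn fun i : Fin (n + 1) => u ⟨i.1 + 1, by omega⟩).prod) ∈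
      TId K (↥(algA K (ℕ →₀ K))) := by
  intro φ
  let ψ : FreeAlgebra K ℕ →+* ExteriorAlgebra K (ℕ →₀ K) :=
    (algALowerEntry K (ℕ →₀ K)).comp (φ : FreeAlgebra K ℕ →+* ↥(algA K (ℕ →₀ K)))
  have map_br (a b) : φ (br a b) = br (φ a) (φ b) := by simp [br]
  have ψ_br (a b) : ψ (br a b) = br (ψ a) (ψ b) := by simp [br]
  rw [mul_assoc (u 0 * br v₁ v₂), mul_assoc (u 0 * br v₁ v₂), ← mul_smul_comm, ← mul_sub,
    map_mul, map_mul, map_br]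
  refine algA_mul_br_mul_eq_zero _ _ _ _ ?_
  change ψ _ = 0
  rw [map_sub, sub_eq_zero, map_zsmul, map_mul, map_mul, map_list_prod, map_list_prod,
    map_list_prod, List.map_ofFn, List.map_ofFn, List.map_ofFn]
  simp only [Function.comp_def, map_mul, ψ_br]
  exact grassmann_prod_br_perm n (fun i => ψ (u ⟨i.1 + 1, by omega⟩)) (fun i => ψ (w i)) σ
end

section
/- For every m ≥ 2 and every n ≥ 2, the left-normed commutator [x₂,x₁,…,x₁] of length m (with m−1 occurrences of x₁) is not a polynomial identity of the relatively free algebra F_n(A). -/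
theorem map_commPow {R S F : Type} [Ring R] [Ring S] [FunLike F R S] [RingHomClass F R S]
    (φ : F) (a b : R) (k : ℕ) : φ (commPow a b k) = commPow (φ a) (φ b) k := by
  unfold commPow
  exact Function.Semiconj.iterate_right (f := φ)
    (fun y => by simp [br]) k a

theorem commPow_of_br_eq {R : Type} [Ring R] {a b : R} (h : br a b = a) (k : ℕ) :
    commPow a b k = a :=
  Function.iterate_fixed h k

/-- The polynomial identities of `R` in `n` variables vanish on `R`, so every substitution of
elements of `R` for the variables factors through the relatively free algebra. -/
theorem IsPI.of_relFree {K R : Type} [Field K] [Ring R] [Algebra K R] {n : ℕ} (hn : 2 ≤ n)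
    {k : ℕ} (h : IsPI K (RelFree K R n) (commPow (xv K 2) (xv K 1) k)) (a b : R) :
    commPow a b k = 0 := by
  let i : Fin n := ⟨0, by omega⟩
  let j : Fin n := ⟨1, by omega⟩
  have hji : j ≠ i := by simp [i, j]
  let q := RingQuot.mkAlgHom K (fun f g : FreeAlgebra K (Fin n) => IsPI K R (f - g))
  let φ : FreeAlgebra K ℕ →ₐ[K] RelFree K R n :=
    FreeAlgebra.lift K fun l => if l = 1 then q (FreeAlgebra.ι K i) else q (FreeAlgebra.ι K j)
  let v : FreeAlgebra K (Fin n) →ₐ[K] R := FreeAlgebra.lift K fun l => if l = i then b else a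
  let ψ : RelFree K R n →ₐ[K] R := RingQuot.liftAlgHom K
    ⟨v, fun f g hfg => sub_eq_zero.mp (by rw [← map_sub]; exact hfg v)⟩
  have hψ (x : FreeAlgebra K (Fin n)) : ψ (q x) = v x :=
    RingQuot.liftAlgHom_mkAlgHom_apply ..
  have ha : ψ (φ (xv K 2)) = a := by
    simp [φ, xv, hψ, v, hji]
  have hb : ψ (φ (xv K 1)) = b := by
    simp [φ, xv, hψ, v]
  have := congrArg ψ (h φ)
  rwa [map_commPow, map_commPow, ha, hb, map_zero] at this

/-- For `m ≥ 2` and `n ≥ 2`, the left-normed commutator `[x₂,x₁,…,x₁]`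
of length `m` (with `m - 1` occurrences of `x₁`) is not a polynomial identity of `F_n(A)`. -/
theorem f1_not_identity_of_relfree (K : Type) [Field K] [CharZero K]
    (m n : ℕ) (hm : 2 ≤ m) (hn : 2 ≤ n) :
    ¬ IsPI K (RelFree K (↥(algA K (ℕ →₀ K))) n) (commPow (xv K 2) (xv K 1) (m - 1)) := by
  intro h
  let a : algA K (ℕ →₀ K) := ⟨Matrix.single 0 1 1, by simp [algA]⟩
  let b : algA K (ℕ →₀ K) := ⟨Matrix.single 1 1 1, by simp [algA]⟩
  have hab : br a b = a := Subtype.ext (by simp [br, a, b])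
  have ha : a = 0 := by rw [← commPow_of_br_eq hab (m - 1)]; exact IsPI.of_relFree hn h a b
  have h01 := congrArg (fun M : algA K (ℕ →₀ K) => M.1 0 1) ha
  simp [a] at h01
end
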